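/- Let L(t) = (i, j, t·k) and let M(t) be the symmetric 3×3 quaternionic matrix with zero diagonal and off-diagonal entries M₁₂ = t·k, M₁₃ = j, M₂₃ = i. Let q = (√2/2)(1 + k) ∈ ℍ and let P be the real orthogonal matrix with rows (0, −1, 0), (1, 0, 0), (0, 0, −1), regarded as a quaternionic matrix. Then L(1) = q·L(−1)·q⁻¹·P⁻¹ and M(1) = q·P·M(−1)·P⁻¹·q⁻¹, where q acts on a quaternionic matrix by conjugating every entry. Moreover det P = −1. -/

import Mathlib

open Quaternion Matrix

/-- `L(t) = (i, j, t·k)`, the row of the `D_{2d}`-symmetric charge-3 ADHM family. -/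
noncomputable def Ltet (t : ℝ) : Matrix (Fin 1) (Fin 3) ℍ[ℝ] :=
  !![(⟨0, 1, 0, 0⟩ : ℍ[ℝ]), (⟨0, 0, 1, 0⟩ : ℍ[ℝ]), (⟨0, 0, 0, t⟩ : ℍ[ℝ])]

/-- `M(t)`, the symmetric matrix of the `D_{2d}`-symmetric charge-3 ADHM family:
zero diagonal, `M₁₂ = t·k`, `M₁₃ = j`, `M₂₃ = i`. -/
noncomputable def Mtet (t : ℝ) : Matrix (Fin 3) (Fin 3) ℍ[ℝ] :=
  !![(0 : ℍ[ℝ]), (⟨0, 0, 0, t⟩ : ℍ[ℝ]), (⟨0, 0, 1, 0⟩ : ℍ[ℝ]);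
     (⟨0, 0, 0, t⟩ : ℍ[ℝ]), (0 : ℍ[ℝ]), (⟨0, 1, 0, 0⟩ : ℍ[ℝ]);
     (⟨0, 0, 1, 0⟩ : ℍ[ℝ]), (⟨0, 1, 0, 0⟩ : ℍ[ℝ]), (0 : ℍ[ℝ])]

/-- The unit quaternion `q = (√2/2)(1 + k)`. -/
noncomputable def qrot : ℍ[ℝ] := ⟨Real.sqrt 2 / 2, 0, 0, Real.sqrt 2 / 2⟩

/-- The real orthogonal matrix `P` with rows `(0, −1, 0)`, `(1, 0, 0)`, `(0, 0, −1)`. -/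
def Prot : Matrix (Fin 3) (Fin 3) ℝ :=
  !![0, -1, 0; 1, 0, 0; 0, 0, -1]

theorem sqrt_two_div_two_mul_self : √2 / 2 * (√2 / 2) = (1 / 2 : ℝ) := by
  rw [div_mul_div_comm, Real.mul_self_sqrt zero_le_two]
  norm_num

theorem qrot_inv : qrot⁻¹ = star qrot := by
  have h := sqrt_two_div_two_mul_self
  refine inv_eq_of_mul_eq_one_right (Quaternion.ext _ _ ?_ ?_ ?_ ?_) <;>
    (simp; simp [qrot]; try linarith)

/-- Conjugation by `qrot` is the rotation through `π / 2` about the `k`-axis. -/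
theorem qrot_mul_mul_inv (x : ℍ[ℝ]) :
    qrot * x * qrot⁻¹ = (⟨x.re, -x.imJ, x.imI, x.imK⟩ : ℍ[ℝ]) := by
  have h := sqrt_two_div_two_mul_self
  rw [qrot_inv]
  refine Quaternion.ext _ _ ?_ ?_ ?_ ?_ <;>
    simp only [Quaternion.re_mul, Quaternion.imI_mul, Quaternion.imJ_mul,
      Quaternion.imK_mul, Quaternion.re_star, Quaternion.imI_star, Quaternion.imJ_star,
      Quaternion.imK_star] <;>
    simp only [qrot]
  · linear_combination 2 * x.re * h
  · linear_combination -2 * x.imJ * h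
  · linear_combination 2 * x.imI * h
  · linear_combination 2 * x.imK * h

theorem Prot_inv : Prot⁻¹ = Protᵀ := by
  refine Matrix.inv_eq_right_inv ?_
  ext i j
  fin_cases i <;> fin_cases j <;> simp [Prot, Matrix.mul_apply, Fin.sum_univ_three]

/-- the two tetrahedral ADHM data sets are related by
`L(1) = q·L(−1)·q⁻¹·P⁻¹` and `M(1) = q·P·M(−1)·P⁻¹·q⁻¹`, where `q` acts on a
quaternionic matrix by conjugating every entry, and `det P = −1`. -/
theorem adhm_tetrahedra_related_by_gauge :
    Ltet 1 = ((Ltet (-1)).map fun a => qrot * a * qrot⁻¹) *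
        ((Prot⁻¹).map fun r => (r : ℍ[ℝ])) ∧
    Mtet 1 = ((Prot.map fun r => (r : ℍ[ℝ])) * Mtet (-1) *
        ((Prot⁻¹).map fun r => (r : ℍ[ℝ]))).map (fun a => qrot * a * qrot⁻¹) ∧
    Prot.det = -1 := by
  rw [Prot_inv]
  refine ⟨Matrix.ext fun i j => ?_, Matrix.ext fun i j => ?_, ?_⟩
  · simp only [Matrix.mul_apply, Matrix.map_apply, Fin.sum_univ_three]
    refine Quaternion.ext _ _ ?_ ?_ ?_ ?_ <;>
      simp only [Quaternion.re_add, Quaternion.imI_add, Quaternion.imJ_add, Quaternion.imK_add,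
        Quaternion.mul_coe_eq_smul, Quaternion.re_smul, Quaternion.imI_smul,
        Quaternion.imJ_smul, Quaternion.imK_smul] <;>
      simp only [qrot_mul_mul_inv] <;>
      fin_cases i <;> fin_cases j <;> simp [Ltet, Prot]
  · rw [Matrix.map_apply, qrot_mul_mul_inv]
    simp only [Matrix.mul_apply, Matrix.map_apply, Fin.sum_univ_three]
    refine Quaternion.ext _ _ ?_ ?_ ?_ ?_ <;> simp <;>
      fin_cases i <;> fin_cases j <;> simp [Mtet, Prot]
  · simp [Prot, Matrix.det_fin_three]
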